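/- Let k** ∈ ℕ, let G be a finite graph with the non-k**-tree property, let f : ℕ → ℕ∖{0} be nondecreasing, and let m_0 > m_1 > … > m_{k**} be nonzero natural numbers with f(m_ℓ) ≥ m_{ℓ+1} for every ℓ < k**. Then for every A ⊆ G there exists a finite sequence ⟨A_j : j < m⟩ of pairwise disjoint subsets of A such that each A_j is f-indivisible, each |A_j| ∈ {m_ℓ : ℓ < k**}, and |A ∖ ⋃_{j<m} A_j| < m_0. -/

import Mathlib

open Finset

open scoped Classical

namespace Paper

variable {V : Type}

/-- `G` has the `k`-order property. -/
def HasOrderProp (G : SimpleGraph V) (k : ℕ) : Prop :=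
  ∃ a b : Fin k → V, ∀ i j : Fin k, i < j → G.Adj (a i) (b j) ∧ ¬ G.Adj (a j) (b i)

/-- `G` has the non-`k`-order property. -/
def NoOrderProp (G : SimpleGraph V) (k : ℕ) : Prop := ¬ HasOrderProp G k

/-- `G` has the non-`k`-tree property. -/
def NoTreeProp (G : SimpleGraph V) (k : ℕ) : Prop :=
  ¬ ∃ (a : (Fin k → Bool) → V) (b : (m : Fin k) → (Fin (m : ℕ) → Bool) → V),
      ∀ (η : Fin k → Bool) (m : Fin k) (ρ : Fin (m : ℕ) → Bool),
        (∀ i : Fin (m : ℕ), η ⟨i.1, i.2.trans m.2⟩ = ρ i) →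
        (G.Adj (a η) (b m ρ) ↔ η m = true)

/-- The truth value `t` is the `ζ`-average of the vertex `a` over the set `B`:
all but fewer than `ζ|B|` of the `b ∈ B` satisfy `(a R b) ≡ t`. -/
def AvgIs (G : SimpleGraph V) (ζ : ℝ) (B : Finset V) (a : V) (t : Bool) : Prop :=
  ((B.filter fun b => ¬ (G.Adj a b ↔ t = true)).card : ℝ) < ζ * B.card

/-- `A` is `ε`-good. -/
def Good (G : SimpleGraph V) (ε : ℝ) (A : Finset V) : Prop :=
  ∀ b : V, ∃ t : Bool, AvgIs G ε A b t

/-- `A` is `(ε,ζ)`-excellent. -/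
def Excellent (G : SimpleGraph V) (ε ζ : ℝ) (A : Finset V) : Prop :=
  Good G ε A ∧
    ∀ B : Finset V, Good G ζ B →
      ∃ t : Bool, ((A.filter fun a => ¬ AvgIs G ζ B a t).card : ℝ) < ε * A.card

/-- The pair `(A,B)` is `(ε,ζ)`-uniform. -/
def Uniform (G : SimpleGraph V) (ε ζ : ℝ) (A B : Finset V) : Prop :=
  ∃ t : Bool, ((A.filter fun a => ¬ AvgIs G ζ B a t).card : ℝ) < ε * A.card

/-- `A` is `f`-indivisible. -/
def Indivisible (G : SimpleGraph V) (f : ℕ → ℕ) (A : Finset V) : Prop :=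
  ∀ b : V, ∃ t : Bool, (A.filter fun a => ¬ (G.Adj a b ↔ t = true)).card < f A.card

/-- `A` is `ε`-indivisible, for a real `ε ∈ (0,1)`. -/
def EpsIndivisible (G : SimpleGraph V) (ε : ℝ) (A : Finset V) : Prop :=
  ∀ b : V, ∃ t : Bool,
    ((A.filter fun a => ¬ (G.Adj a b ↔ t = true)).card : ℝ) < (A.card : ℝ) ^ ε

/-- The edge density between `A` and `B`. -/
noncomputable def density (G : SimpleGraph V) (A B : Finset V) : ℝ :=
  (((A ×ˢ B).filter fun p => G.Adj p.1 p.2).card : ℝ) / (A.card * B.card)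

/-- The pair `(A,B)` is `ε`-regular. -/
def Regular (G : SimpleGraph V) (ε : ℝ) (A B : Finset V) : Prop :=
  ∀ A' ⊆ A, ∀ B' ⊆ B, ε * A.card ≤ (A'.card : ℝ) → ε * B.card ≤ (B'.card : ℝ) →
    |density G A B - density G A' B'| < ε

/-- The sequence `⟨a_i : i < n⟩` is `Δ_k`-indiscernible. -/
def DeltaIndiscernible (G : SimpleGraph V) (k : ℕ) {n : ℕ} (a : Fin n → V) : Prop :=
  Function.Injective a ∧
  (∀ i₀ i₁ j₀ j₁ : Fin n, i₀ < i₁ → j₀ < j₁ →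
    (G.Adj (a i₀) (a i₁) ↔ G.Adj (a j₀) (a j₁))) ∧
  (∀ m : ℕ, m ≤ k → ∀ i j : Fin k → Fin n, StrictMono i → StrictMono j →
    (((∃ y : V, (∀ ℓ : Fin k, (ℓ : ℕ) < m → G.Adj y (a (i ℓ))) ∧
                (∀ ℓ : Fin k, m ≤ (ℓ : ℕ) → ¬ G.Adj y (a (i ℓ)))) ↔
      (∃ y : V, (∀ ℓ : Fin k, (ℓ : ℕ) < m → G.Adj y (a (j ℓ))) ∧
                (∀ ℓ : Fin k, m ≤ (ℓ : ℕ) → ¬ G.Adj y (a (j ℓ))))) ∧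
     ((∃ y : V, (∀ ℓ : Fin k, (ℓ : ℕ) < m → ¬ G.Adj y (a (i ℓ))) ∧
                (∀ ℓ : Fin k, m ≤ (ℓ : ℕ) → G.Adj y (a (i ℓ)))) ↔
      (∃ y : V, (∀ ℓ : Fin k, (ℓ : ℕ) < m → ¬ G.Adj y (a (j ℓ))) ∧
                (∀ ℓ : Fin k, m ≤ (ℓ : ℕ) → G.Adj y (a (j ℓ)))))))

end Paper

open Paper

/-- A binary tree of vertex sets, each obtained from its parent by the splitting rule `next`;
`branchSet next B η ℓ` is the node reached from the root `B` along the first `ℓ` values of `η`. -/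
def branchSet {V : Type} (next : ℕ → Finset V → Bool → Finset V) (B : Finset V)
    (η : ℕ → Bool) : ℕ → Finset V
  | 0 => B
  | ℓ + 1 => next ℓ (branchSet next B η ℓ) (η ℓ)

theorem branchSet_congr {V : Type} (next : ℕ → Finset V → Bool → Finset V) (B : Finset V)
    (η θ : ℕ → Bool) (ℓ : ℕ) (h : ∀ i < ℓ, η i = θ i) :
    branchSet next B η ℓ = branchSet next B θ ℓ := by
  induction ℓ with
  | zero => rfl
  | succ ℓ ih =>
    simp only [branchSet]
    rw [ih fun i hi => h i (by omega), h ℓ (by omega)]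

/-- The extension of a finite binary sequence to an infinite one by `false`. -/
def extendFalse {n : ℕ} (ρ : Fin n → Bool) (i : ℕ) : Bool :=
  if h : i < n then ρ ⟨i, h⟩ else false

/-- In a graph with the non-`k`-tree property, a vertex set of size `m 0` cannot be split
repeatedly, `k` times, into halves of sizes `m 1, …, m k`. -/
theorem Paper.NoTreeProp.not_forall_split {V : Type} {G : SimpleGraph V} {k : ℕ}
    (hG : NoTreeProp G k) {m : ℕ → ℕ} (hm : 0 < m k) {B : Finset V} (hB : B.card = m 0) :
    ¬ ∀ ℓ < k, ∀ S ⊆ B, S.card = m ℓ → ∃ v, ∀ t : Bool, ∃ S' ⊆ S, S'.card = m (ℓ + 1) ∧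
      ∀ a ∈ S', G.Adj a v ↔ t = true := by
  intro h
  rcases isEmpty_or_nonempty V with hV | ⟨⟨v₀⟩⟩
  · have hB0 : B = ∅ := Finset.eq_empty_of_isEmpty B
    rcases Nat.eq_zero_or_pos k with rfl | hk
    · simp [hB0] at hB
      omega
    · obtain ⟨v, -⟩ := h 0 hk B subset_rfl hB
      exact hV.elim v
  have h' : ∀ ℓ S, ∃ v, ∀ t : Bool, ∃ S', ℓ < k → S ⊆ B → S.card = m ℓ →
      S' ⊆ S ∧ S'.card = m (ℓ + 1) ∧ ∀ a ∈ S', G.Adj a v ↔ t = true := by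
    intro ℓ S
    by_cases hS : ℓ < k ∧ S ⊆ B ∧ S.card = m ℓ
    · obtain ⟨v, hv⟩ := h ℓ hS.1 S hS.2.1 hS.2.2
      refine ⟨v, fun t => ?_⟩
      obtain ⟨S', hS'⟩ := hv t
      exact ⟨S', fun _ _ _ => hS'⟩
    · exact ⟨v₀, fun _ => ⟨S, fun h₁ h₂ h₃ => absurd ⟨h₁, h₂, h₃⟩ hS⟩⟩
  choose v next hnext using h'
  have hT : ∀ η ℓ, ℓ ≤ k →
      branchSet next B η ℓ ⊆ B ∧ (branchSet next B η ℓ).card = m ℓ := by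
    intro η ℓ
    induction ℓ with
    | zero => exact fun _ => ⟨subset_rfl, hB⟩
    | succ ℓ ih =>
      intro hℓ
      obtain ⟨h₁, h₂⟩ := ih (by omega)
      obtain ⟨h₃, h₄, -⟩ := hnext ℓ _ (η ℓ) (by omega) h₁ h₂
      exact ⟨h₃.trans h₁, h₄⟩
  have hanti : ∀ η i d, i + d ≤ k →
      branchSet next B η (i + d) ⊆ branchSet next B η i := by
    intro η i d
    induction d with
    | zero => exact fun _ => subset_rfl
    | succ d ih =>
      intro hd
      obtain ⟨h₁, h₂⟩ := hT η (i + d) (by omega)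
      exact (hnext (i + d) _ (η (i + d)) (by omega) h₁ h₂).1.trans (ih (by omega))
  have hne : ∀ η, (branchSet next B η k).Nonempty := fun η =>
    Finset.card_pos.1 ((hT η k le_rfl).2 ▸ hm)
  choose a ha using hne
  refine hG ⟨fun η => a (extendFalse η),
    fun i ρ => v i (branchSet next B (extendFalse ρ) i), fun η i ρ hρ => ?_⟩
  have hcongr : branchSet next B (extendFalse ρ) i = branchSet next B (extendFalse η) i := by
    refine branchSet_congr next B _ _ i fun j hj => ?_
    have hjk : j < k := hj.trans i.2
    simpa [extendFalse, hj, hjk] using (hρ ⟨j, hj⟩).symm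
  obtain ⟨h₁, h₂⟩ := hT (extendFalse η) i i.2.le
  have hmem : a (extendFalse η) ∈ branchSet next B (extendFalse η) (i + 1) := by
    have hik : (i : ℕ) + 1 + (k - (i + 1)) = k := by omega
    have := hanti (extendFalse η) (i + 1) (k - (i + 1)) hik.le
    rw [hik] at this
    exact this (ha _)
  have hηi : extendFalse η i = η i := by simp [extendFalse]
  have := (hnext i _ (extendFalse η i) i.2 h₁ h₂).2.2 _ hmem
  rw [hηi] at this
  simpa only [hcongr] using this

/-- A set which is not `f`-indivisible is split by some vertex into two parts of size at least
`f` of its cardinality. -/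
theorem exists_split_of_not_indivisible {V : Type} {G : SimpleGraph V} {f : ℕ → ℕ}
    {S : Finset V} (hS : ¬ Indivisible G f S) {n : ℕ} (hn : n ≤ f S.card) :
    ∃ v, ∀ t : Bool, ∃ S' ⊆ S, S'.card = n ∧ ∀ a ∈ S', G.Adj a v ↔ t = true := by
  unfold Indivisible at hS
  push Not at hS
  obtain ⟨v, hv⟩ := hS
  refine ⟨v, fun t => ?_⟩
  obtain ⟨S', hS', hcard⟩ := Finset.exists_subset_card_eq (hn.trans (hv !t))
  refine ⟨S', hS'.trans (Finset.filter_subset _ _), hcard, fun a ha => ?_⟩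
  have := (Finset.mem_filter.1 (hS' ha)).2
  cases t <;> simpa using this

theorem Paper.NoTreeProp.exists_indivisible_subset {V : Type} {G : SimpleGraph V} {k : ℕ}
    (hG : NoTreeProp G k) {f m : ℕ → ℕ} (hm : 0 < m k)
    (hfm : ∀ ℓ, ℓ < k → m (ℓ + 1) ≤ f (m ℓ)) {A : Finset V} (hA : m 0 ≤ A.card) :
    ∃ S ⊆ A, Indivisible G f S ∧ ∃ ℓ < k, S.card = m ℓ := by
  by_contra! hcon
  obtain ⟨B, hBA, hB⟩ := Finset.exists_subset_card_eq hA
  refine hG.not_forall_split hm hB fun ℓ hℓ S hSB hS => ?_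
  refine exists_split_of_not_indivisible (f := f) (fun hind => ?_) (hS ▸ hfm ℓ hℓ)
  exact hcon S (hSB.trans hBA) hind ℓ hℓ hS

theorem stmt13 (kss : ℕ) (V : Type) [Fintype V] (G : SimpleGraph V)
    (hG : NoTreeProp G kss) (f : ℕ → ℕ) (hf1 : ∀ n, 0 < f n) (hf2 : Monotone f)
    (m : ℕ → ℕ) (hm0 : ∀ ℓ, ℓ ≤ kss → 0 < m ℓ)
    (hdec : ∀ ℓ, ℓ < kss → m (ℓ + 1) < m ℓ)
    (hfm : ∀ ℓ, ℓ < kss → m (ℓ + 1) ≤ f (m ℓ)) :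
    ∀ A : Finset V,
      ∃ (mm : ℕ) (P : Fin mm → Finset V),
        (∀ j, P j ⊆ A) ∧
        (∀ i j, i ≠ j → Disjoint (P i) (P j)) ∧
        (∀ j, Indivisible G f (P j)) ∧
        (∀ j, ∃ ℓ < kss, (P j).card = m ℓ) ∧
        (A.filter fun a => ∀ j, a ∉ P j).card < m 0 := by
  intro A
  induction A using Finset.strongInduction with
  | H A ih =>
  by_cases hA : A.card < m 0
  · exact ⟨0, Fin.elim0, fun j => j.elim0, fun j => j.elim0, fun j => j.elim0,
      fun j => j.elim0, (Finset.card_filter_le _ _).trans_lt hA⟩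
  obtain ⟨S, hSA, hS, ℓ, hℓ, hcard⟩ :=
    hG.exists_indivisible_subset (hm0 kss le_rfl) hfm (not_lt.1 hA)
  have hSne : S.Nonempty := Finset.card_pos.1 (hcard ▸ hm0 ℓ hℓ.le)
  obtain ⟨n, P, hPA, hdisj, hind, hsize, hrest⟩ := ih (A \ S) (Finset.sdiff_ssubset hSA hSne)
  have hSP : ∀ j, Disjoint S (P j) := fun j =>
    Finset.disjoint_sdiff.mono_right (hPA j)
  refine ⟨n + 1, Fin.cons S P, ?_, ?_, ?_, ?_, ?_⟩
  · exact Fin.cases hSA fun j => (hPA j).trans Finset.sdiff_subset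
  · refine Fin.cases (Fin.cases (fun h => absurd rfl h) fun j _ => hSP j)
      fun i => Fin.cases (fun _ => (hSP i).symm) fun j hij => hdisj i j ?_
    rintro rfl
    exact hij rfl
  · exact Fin.cases hS hind
  · exact Fin.cases ⟨ℓ, hℓ, hcard⟩ hsize
  · convert hrest using 2
    ext a
    simp [Fin.forall_fin_succ, and_assoc]
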